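/- For every integer k ≥ 0, co-Λ_k ⊆ Λ_{k+1}: if the complement of a distributed language L is in Λ_k, then L is in Λ_{k+1}. -/

import Mathlib

/-!
Distributed decision in the LOCAL model: configurations, local algorithms,
the local hierarchy Σ_k / Π_k / Λ_k and co-Λ_k.
-/

/-- A configuration: a finite connected simple graph on `Fin n` (with `n ≥ 1`)
together with an input bit string at each node. -/
structure Config where
  n : ℕ
  npos : 0 < n
  G : SimpleGraph (Fin n)
  conn : G.Connected
  x : Fin n → List Bool

/-- The ball of radius `t` around `v`: all nodes at distance at most `t`. -/
def ball (C : Config) (v : Fin C.n) (t : ℕ) : Set (Fin C.n) :=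
  {u | C.G.dist v u ≤ t}

lemma self_mem_ball (C : Config) (v : Fin C.n) (t : ℕ) : v ∈ ball C v t := by
  simp [ball, SimpleGraph.dist_self]

/-- A `t`-round local algorithm: at each node it outputs a bit, computed from the whole
configuration, identity assignment and labellings, subject to locality: the output at `v`
only depends on the ball of radius `t` around `v` together with the inputs, identities and
labellings on it (isomorphic labelled balls give equal outputs). -/
structure LocalAlg where
  t : ℕ
  run : (C : Config) → (Fin C.n → ℕ) → (ℕ → Fin C.n → List Bool) → Fin C.n → Bool
  isLocal : ∀ (C C' : Config) (ident : Fin C.n → ℕ) (ident' : Fin C'.n → ℕ)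
      (ℓ : ℕ → Fin C.n → List Bool) (ℓ' : ℕ → Fin C'.n → List Bool)
      (v : Fin C.n) (v' : Fin C'.n)
      (φ : (C.G.induce (ball C v t)) ≃g (C'.G.induce (ball C' v' t))),
      ((φ ⟨v, self_mem_ball C v t⟩).val = v') →
      (∀ u : ball C v t, C'.x (φ u).val = C.x u.val) →
      (∀ u : ball C v t, ident' (φ u).val = ident u.val) →
      (∀ (i : ℕ) (u : ball C v t), ℓ' i (φ u).val = ℓ i u.val) →
      run C ident ℓ v = run C' ident' ℓ' v'

/-- A labelling of size `c · log₂ n`. -/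
def goodLabel (c : ℕ) (C : Config) (ℓ : Fin C.n → List Bool) : Prop :=
  ∀ v, (ℓ v).length ≤ c * Nat.log 2 C.n

/-- Alternating quantification over `j` further labellings (stored at indices `i, i+1, …`),
starting with an existential quantifier when the `Bool` argument is `true` and with a
universal quantifier when it is `false`; `P` is the final predicate. -/
def altQ (c : ℕ) (C : Config) (P : (ℕ → Fin C.n → List Bool) → Prop) :
    ℕ → ℕ → Bool → (ℕ → Fin C.n → List Bool) → Prop
  | 0, _, _, ℓs => P ℓs
  | j + 1, i, true, ℓs =>
      ∃ ℓ, goodLabel c C ℓ ∧ altQ c C P j (i + 1) false (Function.update ℓs i ℓ)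
  | j + 1, i, false, ℓs =>
      ∀ ℓ, goodLabel c C ℓ → altQ c C P j (i + 1) true (Function.update ℓs i ℓ)

/-- Global acceptance: every node outputs 1. -/
def accepts (A : LocalAlg) (C : Config) (ident : Fin C.n → ℕ)
    (ℓs : ℕ → Fin C.n → List Bool) : Prop :=
  ∀ v, A.run C ident ℓs v = true

/-- The empty collection of labellings. -/
def noLabels (C : Config) : ℕ → Fin C.n → List Bool := fun _ _ => []

/-- Inputs are bounded by `α · log₂ n` bits. -/
def BoundedInput (α : ℕ) (C : Config) : Prop :=
  ∀ v, (C.x v).length ≤ α * Nat.log 2 C.n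

/-- An identity assignment: injective, with values in `{1, …, n^β}`. -/
def IsIdAssignment (β : ℕ) (C : Config) (ident : Fin C.n → ℕ) : Prop :=
  Function.Injective ident ∧ ∀ v, 1 ≤ ident v ∧ ident v ≤ C.n ^ β

/-- The class `Σ_k` (with input-size constant `α` and identity-space constant `β`):
`(G,x) ∈ L ⟺ ∃ℓ₁ ∀ℓ₂ … Q ℓ_k`, `A` accepts, for every identity assignment. -/
def SigmaC (α β k : ℕ) (L : Set Config) : Prop :=
  ∃ (A : LocalAlg) (c : ℕ), ∀ C : Config, BoundedInput α C →
    ∀ ident : Fin C.n → ℕ, IsIdAssignment β C ident →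
      (C ∈ L ↔ altQ c C (accepts A C ident) k 0 true (noLabels C))

/-- The class `Π_k`: as `Σ_k` but the alternation starts with a universal quantifier. -/
def PiC (α β k : ℕ) (L : Set Config) : Prop :=
  ∃ (A : LocalAlg) (c : ℕ), ∀ C : Config, BoundedInput α C →
    ∀ ident : Fin C.n → ℕ, IsIdAssignment β C ident →
      (C ∈ L ↔ altQ c C (accepts A C ident) k 0 false (noLabels C))

/-- `Λ_k := Σ_k` for odd `k`, `Λ_k := Π_k` for even `k` (so `Λ_0 = LD`). -/
def LambdaC (α β k : ℕ) (L : Set Config) : Prop :=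
  if k % 2 = 1 then SigmaC α β k L else PiC α β k L

/-- `co-Λ_k`: the complement (within the set of all configurations) is in `Λ_k`. -/
def coLambdaC (α β k : ℕ) (L : Set Config) : Prop :=
  LambdaC α β k ({C : Config | BoundedInput α C} \ L)

/-- Input-preserving isomorphism of configurations. -/
def ConfigIso (C C' : Config) : Prop :=
  ∃ φ : C.G ≃g C'.G, ∀ v, C'.x (φ v) = C.x v

/-- A distributed language: a set of configurations (with bounded inputs)
closed under input-preserving isomorphism. -/
def IsDistLang (α : ℕ) (L : Set Config) : Prop :=
  (∀ C ∈ L, BoundedInput α C) ∧ ∀ C C', ConfigIso C C' → (C ∈ L ↔ C' ∈ L)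

/-- The leading quantifier of `Λ_k`: existential iff `k` is odd. -/
def startEx (k : ℕ) : Bool := decide (k % 2 = 1)

/-- Decoding of bit strings as natural numbers in bijective base two. -/
def bijDecode : List Bool → ℕ
  | [] => 0
  | b :: l => 2 * bijDecode l + 1 + b.toNat

lemma exists_bijDecode_eq (d : ℕ) :
    ∃ l : List Bool, l.length ≤ Nat.log 2 (d + 1) ∧ bijDecode l = d := by
  induction d using Nat.strong_induction_on with
  | _ d ih =>
    rcases d with _ | d
    · exact ⟨[], by simp, rfl⟩
    · obtain ⟨l, hl, hd⟩ := ih (d / 2) (by omega)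
      refine ⟨decide (d % 2 = 1) :: l, ?_, ?_⟩
      · have h1 : Nat.log 2 ((d / 2 + 1) * 2) = Nat.log 2 (d / 2 + 1) + 1 :=
          Nat.log_mul_base (by norm_num) (by omega)
        have h2 : Nat.log 2 ((d / 2 + 1) * 2) ≤ Nat.log 2 (d + 1 + 1) :=
          Nat.log_mono_right (by omega)
        simp only [List.length_cons]
        omega
      · rcases Nat.mod_two_eq_zero_or_one d with h | h <;> simp [bijDecode, hd, h] <;> omega

lemma Config.dist_lt (C : Config) (u v : Fin C.n) : C.G.dist u v < C.n := by
  obtain ⟨p, hp, hl⟩ := C.conn.exists_path_of_dist u v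
  simpa [← hl] using hp.length_lt

lemma Config.exists_adj_dist_of_dist_eq_succ (C : Config) {v u : Fin C.n} {d : ℕ}
    (h : C.G.dist v u = d + 1) : ∃ w, C.G.Adj w u ∧ C.G.dist v w = d := by
  obtain ⟨p, hl⟩ := C.conn.exists_walk_length_eq_dist u v
  rw [SimpleGraph.dist_comm, h] at hl
  cases p with
  | nil => simp at hl
  | @cons _ w _ hadj q =>
    refine ⟨w, hadj.symm, ?_⟩
    have h1 : C.G.dist w v ≤ q.length := SimpleGraph.dist_le q
    have h2 : C.G.dist v u ≤ C.G.dist v w + C.G.dist w u := C.conn.dist_triangle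
    have h3 : C.G.dist w u = 1 := SimpleGraph.dist_eq_one_iff_adj.mpr hadj.symm
    rw [SimpleGraph.dist_comm] at h1
    simp only [SimpleGraph.Walk.length_cons] at hl
    omega

/-- A centre-preserving isomorphism between balls does not increase distances to the centre. -/
lemma ballIso_dist_le {C C' : Config} {v : Fin C.n} {v' : Fin C'.n} {t : ℕ}
    (φ : C.G.induce (ball C v t) ≃g C'.G.induce (ball C' v' t))
    (h0 : (φ ⟨v, self_mem_ball C v t⟩).val = v') (d : ℕ) :
    ∀ u : ball C v t, C.G.dist v u.val ≤ d → C'.G.dist v' (φ u).val ≤ d := by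
  induction d with
  | zero =>
    rintro ⟨u, hu⟩ hd
    obtain rfl : v = u := C.conn.dist_eq_zero_iff.mp (Nat.le_zero.mp hd)
    rw [h0, SimpleGraph.dist_self]
  | succ d ih =>
    rintro ⟨u, hu⟩ hd
    rcases Nat.lt_or_ge (C.G.dist v u) (d + 1) with h | h
    · exact (ih ⟨u, hu⟩ (by simpa using Nat.lt_succ_iff.mp h)).trans (Nat.le_succ d)
    · have he : C.G.dist v u = d + 1 := le_antisymm hd h
      obtain ⟨w, hw, hwd⟩ := C.exists_adj_dist_of_dist_eq_succ he
      have hwt : w ∈ ball C v t := by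
        have : C.G.dist v u ≤ t := hu
        change C.G.dist v w ≤ t
        omega
      have h1 := ih ⟨w, hwt⟩ hwd.le
      have hadj : C'.G.Adj (φ ⟨w, hwt⟩).val (φ ⟨u, hu⟩).val :=
        (φ.map_adj_iff (v := ⟨w, hwt⟩) (w := ⟨u, hu⟩)).mpr hw
      have h2 : C'.G.dist v' (φ ⟨u, hu⟩).val ≤
          C'.G.dist v' (φ ⟨w, hwt⟩).val + C'.G.dist (φ ⟨w, hwt⟩).val (φ ⟨u, hu⟩).val :=
        C'.conn.dist_triangle
      have h3 := SimpleGraph.dist_eq_one_iff_adj.mpr hadj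
      omega

lemma ballIso_symm_center {C C' : Config} {v : Fin C.n} {v' : Fin C'.n} {t : ℕ}
    (φ : C.G.induce (ball C v t) ≃g C'.G.induce (ball C' v' t))
    (h0 : (φ ⟨v, self_mem_ball C v t⟩).val = v') :
    (φ.symm ⟨v', self_mem_ball C' v' t⟩).val = v := by
  have h : (⟨v', self_mem_ball C' v' t⟩ : ball C' v' t) = φ ⟨v, self_mem_ball C v t⟩ :=
    Subtype.ext h0.symm
  rw [h, RelIso.symm_apply_apply]

lemma ball_subset_succ (C : Config) (v : Fin C.n) (t : ℕ) : ball C v t ⊆ ball C v (t + 1) :=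
  fun _ hu => Nat.le_succ_of_le hu

/-- The restriction of a centre-preserving isomorphism between balls to smaller balls. -/
def ballIsoRestrict {C C' : Config} {v : Fin C.n} {v' : Fin C'.n} {t : ℕ}
    (φ : C.G.induce (ball C v (t + 1)) ≃g C'.G.induce (ball C' v' (t + 1)))
    (h0 : (φ ⟨v, self_mem_ball C v (t + 1)⟩).val = v') :
    C.G.induce (ball C v t) ≃g C'.G.induce (ball C' v' t) where
  toFun u := ⟨(φ ⟨u, ball_subset_succ C v t u.2⟩).val, ballIso_dist_le φ h0 t _ u.2⟩
  invFun u := ⟨(φ.symm ⟨u, ball_subset_succ C' v' t u.2⟩).val,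
    ballIso_dist_le φ.symm (ballIso_symm_center φ h0) t _ u.2⟩
  left_inv u := by simp
  right_inv u := by simp
  map_rel_iff' {a b} :=
    φ.map_adj_iff (v := ⟨a, ball_subset_succ C v t a.2⟩) (w := ⟨b, ball_subset_succ C v t b.2⟩)

/-- Keep the first `m` labellings and blank out all the others. -/
def truncLabels (m : ℕ) {V : Type} (ℓ : ℕ → V → List Bool) : ℕ → V → List Bool :=
  fun i u => if i < m then ℓ i u else []

/-- The local algorithm that only reads the first `m` labellings. -/
def LocalAlg.trunc (A : LocalAlg) (m : ℕ) : LocalAlg where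
  t := A.t
  run C ident ℓ v := A.run C ident (truncLabels m ℓ) v
  isLocal C C' ident ident' ℓ ℓ' v v' φ h0 hx hid hℓ :=
    A.isLocal C C' ident ident' _ _ v v' φ h0 hx hid fun i u => by
      simp only [truncLabels, hℓ i u]

open Classical in
/-- The local algorithm checking that the numbers stored in the labelling of index `m`
strictly decrease along some edge at every node, except at nodes where they vanish,
which must be nodes rejected by `A` on the first `m` labellings. -/
noncomputable def LocalAlg.certReject (A : LocalAlg) (m : ℕ) : LocalAlg where
  t := A.t + 1
  run C ident ℓ v := decide
    ((bijDecode (ℓ m v) = 0 ∧ (A.trunc m).run C ident ℓ v = false) ∨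
      ∃ u, C.G.Adj v u ∧ bijDecode (ℓ m u) < bijDecode (ℓ m v))
  isLocal C C' ident ident' ℓ ℓ' v v' φ h0 hx hid hℓ := by
    have hrun : (A.trunc m).run C ident ℓ v = (A.trunc m).run C' ident' ℓ' v' :=
      (A.trunc m).isLocal C C' ident ident' ℓ ℓ' v v' (ballIsoRestrict φ h0) h0
        (fun u => hx _) (fun u => hid _) (fun i u => hℓ i _)
    have hv : ℓ' m v' = ℓ m v := by
      rw [← hℓ m ⟨v, self_mem_ball C v (A.t + 1)⟩, h0]
    have hnbr : ∀ (D : Config) (a b : Fin D.n), D.G.Adj a b → b ∈ ball D a (A.t + 1) := by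
      intro D a b hab
      have := SimpleGraph.dist_eq_one_iff_adj.mpr hab
      change D.G.dist a b ≤ A.t + 1
      omega
    have hex : (∃ u, C.G.Adj v u ∧ bijDecode (ℓ m u) < bijDecode (ℓ m v)) ↔
        ∃ u, C'.G.Adj v' u ∧ bijDecode (ℓ' m u) < bijDecode (ℓ' m v') := by
      constructor
      · rintro ⟨u, hadj, hlt⟩
        have hu := hnbr C v u hadj
        refine ⟨(φ ⟨u, hu⟩).val, ?_, ?_⟩
        · have h : C'.G.Adj (φ ⟨v, self_mem_ball C v (A.t + 1)⟩).val (φ ⟨u, hu⟩).val :=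
            (φ.map_adj_iff (v := ⟨v, self_mem_ball C v (A.t + 1)⟩) (w := ⟨u, hu⟩)).mpr hadj
          rwa [h0] at h
        · rwa [hv, hℓ m ⟨u, hu⟩]
      · rintro ⟨u, hadj, hlt⟩
        have hu := hnbr C' v' u hadj
        refine ⟨(φ.symm ⟨u, hu⟩).val, ?_, ?_⟩
        · have h : C.G.Adj (φ.symm ⟨v', self_mem_ball C' v' (A.t + 1)⟩).val
              (φ.symm ⟨u, hu⟩).val :=
            (φ.symm.map_adj_iff (v := ⟨v', self_mem_ball C' v' (A.t + 1)⟩)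
              (w := ⟨u, hu⟩)).mpr hadj
          rwa [ballIso_symm_center φ h0] at h
        · have h := hℓ m (φ.symm ⟨u, hu⟩)
          rw [RelIso.apply_symm_apply] at h
          rwa [← h, ← hv]
    exact decide_eq_decide.mpr (by rw [hrun, hex, hv])

lemma truncLabels_update (m : ℕ) {V : Type} (ℓs : ℕ → V → List Bool) (ℓ : V → List Bool)
    (h : ∀ i, m ≤ i → ℓs i = fun _ => []) :
    truncLabels m (Function.update ℓs m ℓ) = ℓs := by
  funext i u
  by_cases hi : i < m
  · simp [truncLabels, hi, Function.update_of_ne hi.ne]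
  · simp [truncLabels, hi, h i (not_lt.mp hi)]

/-- Rejection by `A` is equivalent to the existence of a short certificate for
`A.certReject m`. -/
lemma not_accepts_iff_certReject (A : LocalAlg) (m c : ℕ) (hc : 1 ≤ c) (C : Config)
    (ident : Fin C.n → ℕ) (ℓs : ℕ → Fin C.n → List Bool)
    (h : ∀ i, m ≤ i → ℓs i = fun _ => []) :
    ¬ accepts A C ident ℓs ↔
      ∃ ℓ, goodLabel c C ℓ ∧ accepts (A.certReject m) C ident (Function.update ℓs m ℓ) := by
  have key : ∀ ℓ, accepts (A.certReject m) C ident (Function.update ℓs m ℓ) ↔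
      ∀ v, (bijDecode (ℓ v) = 0 ∧ A.run C ident ℓs v = false) ∨
        ∃ u, C.G.Adj v u ∧ bijDecode (ℓ u) < bijDecode (ℓ v) := by
    intro ℓ
    classical
    refine forall_congr' fun v => decide_eq_true_iff.trans ?_
    simp only [LocalAlg.trunc, truncLabels_update m ℓs ℓ h, Function.update_self]
  simp only [key]
  constructor
  · intro hrej
    obtain ⟨r, hr⟩ := not_forall.mp hrej
    choose enc hlen hdec using exists_bijDecode_eq
    refine ⟨fun v => enc (C.G.dist r v), fun v => ?_, fun v => ?_⟩
    · calc (enc (C.G.dist r v)).length ≤ Nat.log 2 (C.G.dist r v + 1) := hlen _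
        _ ≤ Nat.log 2 C.n := Nat.log_mono_right (C.dist_lt r v)
        _ ≤ c * Nat.log 2 C.n := Nat.le_mul_of_pos_left _ hc
    · simp only [hdec]
      rcases hd : C.G.dist r v with _ | d
      · left
        obtain rfl := C.conn.dist_eq_zero_iff.mp hd
        exact ⟨rfl, by simpa using hr⟩
      · right
        obtain ⟨w, hw, hwd⟩ := C.exists_adj_dist_of_dist_eq_succ hd
        exact ⟨w, hw.symm, by omega⟩
  · rintro ⟨ℓ, -, hℓ⟩ hacc
    have : Nonempty (Fin C.n) := ⟨⟨0, C.npos⟩⟩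
    obtain ⟨v, hv⟩ := Finite.exists_min fun v => bijDecode (ℓ v)
    rcases hℓ v with ⟨-, hrun⟩ | ⟨u, -, hu⟩
    · simp [hacc v] at hrun
    · exact absurd (hv u) (not_le.mpr hu)

lemma startEx_succ (k : ℕ) : startEx (k + 1) = !startEx k := by
  rw [startEx, startEx, ← decide_not, decide_eq_decide]
  omega

lemma goodLabel_nil (c : ℕ) (C : Config) : goodLabel c C fun _ => [] :=
  fun _ => Nat.zero_le _

lemma altQ_not (c : ℕ) (C : Config) (P : (ℕ → Fin C.n → List Bool) → Prop) (j : ℕ) :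
    ∀ (i : ℕ) (b : Bool) (ℓs : ℕ → Fin C.n → List Bool),
      ¬ altQ c C P j i b ℓs ↔ altQ c C (fun ℓ => ¬ P ℓ) j i (!b) ℓs := by
  induction j with
  | zero => intro i b ℓs; rfl
  | succ j ih =>
    intro i b ℓs
    cases b <;> simp only [altQ, Bool.not_true, Bool.not_false, not_forall, not_exists, not_and,
      exists_prop, ih]

/-- If `P` is equivalent to an existential quantification over one more labelling in `Q`, then
the alternations over `P` ending in a universal quantifier can be extended by one. -/
lemma altQ_extend (c : ℕ) (C : Config) (P Q : (ℕ → Fin C.n → List Bool) → Prop) (m : ℕ)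
    (hPQ : ∀ ℓs : ℕ → Fin C.n → List Bool, (∀ i, m ≤ i → ℓs i = fun _ => []) →
      (P ℓs ↔ ∃ ℓ, goodLabel c C ℓ ∧ Q (Function.update ℓs m ℓ))) (j : ℕ) :
    ∀ (i : ℕ) (b : Bool) (ℓs : ℕ → Fin C.n → List Bool), i + j = m → b = startEx (j + 1) →
      (∀ p, i ≤ p → ℓs p = fun _ => []) →
      (altQ c C P j i b ℓs ↔ altQ c C Q (j + 1) i b ℓs) := by
  induction j with
  | zero =>
    rintro i b ℓs rfl rfl hℓs
    exact hPQ ℓs hℓs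
  | succ j ih =>
    rintro i b ℓs him hb hℓs
    have hblank : ∀ ℓ p, i + 1 ≤ p → Function.update ℓs i ℓ p = fun _ => [] := by
      intro ℓ p hp
      rw [Function.update_of_ne (by omega), hℓs p (by omega)]
    have hnot : startEx (j + 1) = !startEx (j + 1 + 1) := by
      rw [startEx_succ (j + 1), Bool.not_not]
    rw [← hb] at hnot
    cases b
    · rw [altQ, altQ]
      exact forall₂_congr fun ℓ _ => ih (i + 1) _ _ (by omega) hnot.symm (hblank ℓ)
    · rw [altQ, altQ]
      exact exists_congr fun ℓ => and_congr_right fun _ =>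
        ih (i + 1) _ _ (by omega) hnot.symm (hblank ℓ)

lemma altQ_const (c : ℕ) (C : Config) (p : Prop) (j : ℕ) :
    ∀ (i : ℕ) (b : Bool) (ℓs : ℕ → Fin C.n → List Bool),
      altQ c C (fun _ => p) j i b ℓs ↔ p := by
  induction j with
  | zero => intro i b ℓs; rfl
  | succ j ih =>
    intro i b ℓs
    cases b
    · simp only [altQ, ih]
      exact ⟨fun h => h _ (goodLabel_nil c C), fun h _ _ => h⟩
    · simp only [altQ, ih]
      exact ⟨fun ⟨_, _, h⟩ => h, fun h => ⟨_, goodLabel_nil c C, h⟩⟩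

lemma altQ_zero_size (C : Config) (P : (ℕ → Fin C.n → List Bool) → Prop) (j : ℕ) :
    ∀ (i : ℕ) (b : Bool), altQ 0 C P j i b (noLabels C) ↔ P (noLabels C) := by
  have hgood : ∀ ℓ, goodLabel 0 C ℓ ↔ ℓ = fun _ => [] := by
    intro ℓ
    simp [goodLabel, funext_iff]
  have hupd : ∀ i, Function.update (noLabels C) i (fun _ => []) = noLabels C := by
    intro i
    exact Function.update_eq_self i (noLabels C)
  induction j with
  | zero => intro i b; rfl
  | succ j ih =>
    intro i b
    cases b <;> simp [altQ, hgood, hupd, ih]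

lemma lambdaC_iff (α β k : ℕ) (L : Set Config) :
    LambdaC α β k L ↔ ∃ (A : LocalAlg) (c : ℕ), ∀ C : Config, BoundedInput α C →
      ∀ ident : Fin C.n → ℕ, IsIdAssignment β C ident →
        (C ∈ L ↔ altQ c C (accepts A C ident) k 0 (startEx k) (noLabels C)) := by
  by_cases h : k % 2 = 1 <;> simp [LambdaC, startEx, h, SigmaC, PiC]

/-- The label-size constant of a language in `Λ_k` can be taken positive. -/
lemma LambdaC.exists_pos {α β k : ℕ} {L : Set Config} (h : LambdaC α β k L) :
    ∃ (A : LocalAlg) (c : ℕ), 1 ≤ c ∧ ∀ C : Config, BoundedInput α C →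
      ∀ ident : Fin C.n → ℕ, IsIdAssignment β C ident →
        (C ∈ L ↔ altQ c C (accepts A C ident) k 0 (startEx k) (noLabels C)) := by
  obtain ⟨A, c, hA⟩ := (lambdaC_iff α β k L).mp h
  rcases Nat.eq_zero_or_pos c with rfl | hc
  · refine ⟨A.trunc 0, 1, le_rfl, fun C hC ident hid => ?_⟩
    rw [hA C hC ident hid, altQ_zero_size]
    have hacc : accepts (A.trunc 0) C ident = fun _ => accepts A C ident (noLabels C) := rfl
    rw [hacc, altQ_const]
  · exact ⟨A, c, hc, hA⟩

/-- For every `k ≥ 0`, `co-Λ_k ⊆ Λ_{k+1}`: if the complement of a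
distributed language `L` is in `Λ_k`, then `L ∈ Λ_{k+1}`. -/
theorem coLambda_subset_Lambda_succ (α β : ℕ) (hβ : 1 ≤ β) (k : ℕ)
    (L : Set Config) (hL : IsDistLang α L) (h : coLambdaC α β k L) :
    LambdaC α β (k + 1) L := by
  obtain ⟨A, c, hc, hA⟩ := LambdaC.exists_pos h
  refine (lambdaC_iff α β (k + 1) L).mpr ⟨A.certReject k, c, fun C hC ident hid => ?_⟩
  have hcompl : C ∈ L ↔ ¬ C ∈ {C : Config | BoundedInput α C} \ L := by
    simp [hC]
  rw [hcompl, hA C hC ident hid, altQ_not, ← startEx_succ]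
  exact altQ_extend c C _ _ k (not_accepts_iff_certReject A k c hc C ident) k 0 _ _
    (Nat.zero_add k) rfl fun _ _ => rfl
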